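/- Let λ = (λ_1,…,λ_m) ∈ W^odd, suppose there exists a chain α_1,…,α_t of degree d ≤ (1^m) from the identity coset to λ, and suppose j̄ = 2n+3−j ∈ {λ_1,…,λ_m} for some j with 2 ≤ j ≤ m. Then 1 ∈ {λ_1,…,λ_j}. -/

import Mathlib

/-- Roots of `R⁺ \ R_P⁺`: the formal symbols `t_i - t_j`, `t_i + t_j` and `2 t_i`. -/
inductive OddRoot : Type where
  | tminus (i j : ℕ) : OddRoot
  | tplus (i j : ℕ) : OddRoot
  | double (i : ℕ) : OddRoot
deriving DecidableEq

namespace OddRoot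

/-- The conditions for a formal symbol to be a root of `R⁺ \ R_P⁺`. -/
def valid (n m : ℕ) : OddRoot → Prop
  | tminus i j => 1 ≤ i ∧ i ≤ m ∧ i < j ∧ j ≤ n + 1
  | tplus i j => 1 ≤ i ∧ i ≤ m ∧ i < j ∧ j ≤ n + 1
  | double i => 1 ≤ i ∧ i ≤ m

/-- The reflection associated to a root, as a (signed) permutation of the
ground set `{1,…,2n+2}` inside `ℕ`, where `ī = 2n+3-i`. -/
def refl (n : ℕ) : OddRoot → Equiv.Perm ℕ
  | tminus i j => Equiv.swap i j * Equiv.swap (2*n+3-i) (2*n+3-j)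
  | tplus i j => Equiv.swap i (2*n+3-j) * Equiv.swap j (2*n+3-i)
  | double i => Equiv.swap i (2*n+3-i)

/-- The degree vector of a root: `deg α k` is the coefficient of the `k`-th
simple coroot in `α∨`. -/
def deg : OddRoot → ℕ → ℤ
  | tminus i j, k => if i ≤ k ∧ k < j then 1 else 0
  | tplus i j, k => (if i ≤ k then (1:ℤ) else 0) + (if j ≤ k then 1 else 0)
  | double i, k => if i ≤ k then 1 else 0

end OddRoot

/-- The total degree of a chain of roots. -/
def chainDeg (L : List OddRoot) (k : ℕ) : ℤ := (L.map (fun α => α.deg k)).sum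

/-- `IsChainTo n m L lam` : the sequence of roots `L = [α₁,…,α_t]` is a chain from the
identity coset to the tuple `lam`, i.e. each `αᵢ` is in `R⁺ \ R_P⁺` and the composite
`w = s_{α₁} ∘ ⋯ ∘ s_{α_t}` satisfies `w i = lam i` for `1 ≤ i ≤ m`. -/
def IsChainTo (n m : ℕ) (L : List OddRoot) (lam : ℕ → ℕ) : Prop :=
  (∀ α ∈ L, α.valid n m) ∧
  ∀ i ∈ Finset.Icc 1 m, ((L.map (OddRoot.refl n)).prod) i = lam i

/-- `W^odd`: tuples `(lam 1, …, lam m)` of pairwise distinct elements of `{1,…,2n+1}`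
with no two entries summing to `2n+3`. -/
def Wodd (n m : ℕ) (lam : ℕ → ℕ) : Prop :=
  (∀ i ∈ Finset.Icc 1 m, lam i ∈ Finset.Icc 1 (2*n+1)) ∧
  (∀ i ∈ Finset.Icc 1 m, ∀ j ∈ Finset.Icc 1 m, i ≠ j → lam i ≠ lam j) ∧
  (∀ i ∈ Finset.Icc 1 m, ∀ j ∈ Finset.Icc 1 m, lam i + lam j ≠ 2*n+3)

/-- `LamEntry lam k i = Λᵏᵢ`, the `i`-th smallest element of `{lam 1, …, lam k}`. -/
def LamEntry (lam : ℕ → ℕ) (k i : ℕ) : ℕ :=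
  (((Finset.Icc 1 k).image lam).sort (· ≤ ·)).getD (i-1) 0

/-- The Bruhat-type order `λ ⪯ δ`: `Λᵏᵢ ≤ Δᵏᵢ` for all `1 ≤ i ≤ k ≤ m`. -/
def Dominates (m : ℕ) (lam del : ℕ → ℕ) : Prop :=
  ∀ k ∈ Finset.Icc 1 m, ∀ i ∈ Finset.Icc 1 k, LamEntry lam k i ≤ LamEntry del k i

/-- The tuples `δʲ`: `δ¹ = ((m+1)̄ | 2 | 3 | ⋯ | m)` and, for `2 ≤ j ≤ m`,
`δʲ = (j̄ | 2 | ⋯ | j-1 | 1 | j+1 | ⋯ | m)`. -/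
def delta (n m j : ℕ) : ℕ → ℕ := fun i =>
  if j = 1 then (if i = 1 then 2*n+2-m else i)
  else if i = 1 then 2*n+3-j else if i = j then 1 else i

/-- The pattern vector `(0^a 1^b c^(m-a-b))`. -/
def patvec (a b : ℕ) (c : ℤ) : ℕ → ℤ := fun k =>
  if k ≤ a then 0 else if k ≤ a + b then 1 else c

/-- The simple reflections `s_k` (`1 ≤ k ≤ n`, swapping `k ↔ k+1` and `k̄ ↔ (k+1)̄`)
and `s_{n+1}` (swapping `n+1 ↔ (n+1)̄ = n+2`). -/
def simpleRefl (n k : ℕ) : Equiv.Perm ℕ :=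
  if k ≤ n then Equiv.swap k (k+1) * Equiv.swap (2*n+3-k) (2*n+2-k)
  else Equiv.swap (n+1) (n+2)

theorem refl_deg_nonneg (α : OddRoot) (k : ℕ) : 0 ≤ α.deg k := by
  cases α <;> simp only [OddRoot.deg] <;> split_ifs <;> simp

theorem chainDeg_nonneg (L : List OddRoot) (k : ℕ) : 0 ≤ chainDeg L k := by
  induction L with
  | nil => simp [chainDeg]
  | cons α L ih =>
    have := refl_deg_nonneg α k
    simp only [chainDeg, List.map_cons, List.sum_cons] at ih ⊢
    omega

/-- A root of degree zero at `j` preserves `{1,…,j}`, compatibly with the bar. -/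
theorem refl_deg_zero (n m j : ℕ) (hmn : m ≤ n) (hjm : j ≤ m) (α : OddRoot)
    (hv : α.valid n m) (hd : α.deg j ≤ 0) (c : ℕ) (h1 : 1 ≤ c) (h2 : c ≤ j) :
    1 ≤ (α.refl n)⁻¹ c ∧ (α.refl n)⁻¹ c ≤ j ∧
      (α.refl n)⁻¹ (2*n+3-c) = 2*n+3 - (α.refl n)⁻¹ c := by
  cases α with
  | tminus a b =>
    simp only [OddRoot.valid, OddRoot.deg, OddRoot.refl, mul_inv_rev, Equiv.swap_inv,
      Equiv.Perm.mul_apply, Equiv.swap_apply_def] at *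
    grind
  | tplus a b =>
    simp only [OddRoot.valid, OddRoot.deg, OddRoot.refl, mul_inv_rev, Equiv.swap_inv,
      Equiv.Perm.mul_apply, Equiv.swap_apply_def] at *
    grind
  | double a =>
    simp only [OddRoot.valid, OddRoot.deg, OddRoot.refl, Equiv.swap_inv,
      Equiv.swap_apply_def] at *
    grind

/-- A root of degree one at `j` moves only one element of `{1,…,j}`. -/
theorem refl_deg_one (n m j : ℕ) (hmn : m ≤ n) (hjm : j ≤ m) (α : OddRoot)
    (hv : α.valid n m) (hd : α.deg j = 1) (c e : ℕ) (h1 : 1 ≤ c) (h2 : c ≤ j)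
    (h3 : 1 ≤ e) (h4 : e ≤ j) (hce : c ≠ e) :
    (α.refl n)⁻¹ c = c ∨ (α.refl n)⁻¹ (2*n+3-e) = 2*n+3-e := by
  cases α with
  | tminus a b =>
    simp only [OddRoot.valid, OddRoot.deg, OddRoot.refl, mul_inv_rev, Equiv.swap_inv,
      Equiv.Perm.mul_apply, Equiv.swap_apply_def] at *
    grind
  | tplus a b =>
    simp only [OddRoot.valid, OddRoot.deg, OddRoot.refl, mul_inv_rev, Equiv.swap_inv,
      Equiv.Perm.mul_apply, Equiv.swap_apply_def] at *
    grind
  | double a =>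
    simp only [OddRoot.valid, OddRoot.deg, OddRoot.refl, Equiv.swap_inv,
      Equiv.swap_apply_def] at *
    grind

theorem chain_deg_zero (n m j : ℕ) (hmn : m ≤ n) (hjm : j ≤ m) (L : List OddRoot)
    (hv : ∀ α ∈ L, α.valid n m) (hd : chainDeg L j ≤ 0) (c : ℕ) (h1 : 1 ≤ c) (h2 : c ≤ j) :
    1 ≤ ((L.map (OddRoot.refl n)).prod)⁻¹ c ∧ ((L.map (OddRoot.refl n)).prod)⁻¹ c ≤ j ∧
      2*n+3-j ≤ ((L.map (OddRoot.refl n)).prod)⁻¹ (2*n+3-c) := by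
  induction L generalizing c with
  | nil => simp; omega
  | cons α L ih =>
    have hα := refl_deg_nonneg α j
    have hL := chainDeg_nonneg L j
    have hs : chainDeg (α :: L) j = α.deg j + chainDeg L j := by simp [chainDeg]
    obtain ⟨p, q, r⟩ := refl_deg_zero n m j hmn hjm α (hv α (by simp)) (by omega) c h1 h2
    have := ih (fun β hβ => hv β (by simp [hβ])) (by omega) _ p q
    simp only [List.map_cons, List.prod_cons, mul_inv_rev, Equiv.Perm.mul_apply]
    rw [r]
    exact this

theorem chain_deg_one (n m j : ℕ) (hmn : m ≤ n) (hjm : j ≤ m) (L : List OddRoot)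
    (hv : ∀ α ∈ L, α.valid n m) (hd : chainDeg L j ≤ 1) (c e : ℕ) (h1 : 1 ≤ c) (h2 : c ≤ j)
    (h3 : 1 ≤ e) (h4 : e ≤ j) (hce : c ≠ e) :
    (1 ≤ ((L.map (OddRoot.refl n)).prod)⁻¹ c ∧ ((L.map (OddRoot.refl n)).prod)⁻¹ c ≤ j) ∨
      2*n+3-j ≤ ((L.map (OddRoot.refl n)).prod)⁻¹ (2*n+3-e) := by
  induction L generalizing c e with
  | nil => simp; omega
  | cons α L ih =>
    have hα := refl_deg_nonneg α j
    have hL := chainDeg_nonneg L j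
    have hs : chainDeg (α :: L) j = α.deg j + chainDeg L j := by simp [chainDeg]
    have hvL : ∀ β ∈ L, β.valid n m := fun β hβ => hv β (by simp [hβ])
    have hvα := hv α (by simp)
    simp only [List.map_cons, List.prod_cons, mul_inv_rev, Equiv.Perm.mul_apply]
    by_cases h0 : α.deg j ≤ 0
    · obtain ⟨p, q, r⟩ := refl_deg_zero n m j hmn hjm α hvα h0 c h1 h2
      obtain ⟨p', q', r'⟩ := refl_deg_zero n m j hmn hjm α hvα h0 e h3 h4
      rw [r']
      exact ih hvL (by omega) _ _ p q p' q' (fun h => hce ((α.refl n)⁻¹.injective h))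
    · rcases refl_deg_one n m j hmn hjm α hvα (by omega) c e h1 h2 h3 h4 hce with h | h
      · left
        rw [h]
        have := chain_deg_zero n m j hmn hjm L hvL (by omega) c h1 h2
        exact ⟨this.1, this.2.1⟩
      · right
        rw [h]
        exact (chain_deg_zero n m j hmn hjm L hvL (by omega) e h3 h4).2.2

/-- Lemma `lem:1inL`, second claim: if `λ ∈ W^odd` is reached from the identity
coset by a chain of degree `d ≤ (1^m)` and `j̄ = 2n+3-j` appears among `λ₁,…,λ_m` for some
`2 ≤ j ≤ m`, then `1 ∈ {λ₁,…,λ_j}`. -/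
theorem one_in_Lambda (n m : ℕ) (hn : 1 ≤ n) (hm : 1 ≤ m) (hmn : m ≤ n)
    (lam : ℕ → ℕ) (hlam : Wodd n m lam)
    (L : List OddRoot) (hchain : IsChainTo n m L lam)
    (hdeg : ∀ k ∈ Finset.Icc 1 m, chainDeg L k ≤ 1)
    (j : ℕ) (hj2 : 2 ≤ j) (hjm : j ≤ m)
    (hbar : ∃ i ∈ Finset.Icc 1 m, lam i = 2*n+3-j) :
    ∃ i ∈ Finset.Icc 1 j, lam i = 1 := by
  obtain ⟨i, hi, hij⟩ := hbar
  obtain ⟨hv, hw⟩ := hchain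
  rw [Finset.mem_Icc] at hi
  have key := chain_deg_one n m j hmn hjm L hv (hdeg j (Finset.mem_Icc.2 ⟨by omega, hjm⟩))
    1 j le_rfl (by omega) (by omega) le_rfl (by omega)
  rcases key with ⟨p, q⟩ | h
  · refine ⟨_, Finset.mem_Icc.2 ⟨p, q⟩, ?_⟩
    rw [← hw _ (Finset.mem_Icc.2 ⟨p, q.trans hjm⟩)]
    simp
  · have hx : ((L.map (OddRoot.refl n)).prod)⁻¹ (2*n+3-j) = i := by
      rw [← hij, ← hw i (Finset.mem_Icc.2 hi)]
      simp
    omega
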